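/- arXiv:2405.21012 — 2 statements merged into one kernel-verified Lean document; each statement's English description precedes it below -/
import Mathlib

section
/- Regression-based iterative G-computation recovers the conditional average potential outcome (Proposition 1, general prediction horizon τ): define the pseudo-outcome regression functions recursively by g_{τ−1} := μ[Y·T_{τ−1} | 𝒢_{τ−1}] / π_{τ−1} and, for δ = τ−2, …, 0, g_δ := μ[g_{δ+1}·T_δ | 𝒢_δ] / π_δ. Then, under consistency, sequential ignorability at every step, and positivity, μ[Ya | 𝒢₀] = g₀ holds μ-almost everywhere. -/
open MeasureTheory ProbabilityTheory

lemma gcomp_int_g {Ω : Type*} {mΩ : MeasurableSpace Ω} {μ : Measure Ω} [IsProbabilityMeasure μ]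
    {m : MeasurableSpace Ω} (hm : m ≤ mΩ) (T h : Ω → ℝ)
    (hpos : ∃ c : ℝ, 0 < c ∧ ∀ᵐ ω ∂μ, c ≤ (μ[T|m]) ω) :
    Integrable (fun ω => (μ[h|m]) ω / (μ[T|m]) ω) μ := by
  obtain ⟨c, hc, hp⟩ := hpos
  simp only [div_eq_mul_inv]
  refine Integrable.mul_bdd (c := c⁻¹) integrable_condExp ?_ ?_
  · exact ((stronglyMeasurable_condExp.measurable.mono hm le_rfl).inv).aestronglyMeasurable
  · filter_upwards [hp] with ω hω
    rw [Real.norm_eq_abs, abs_of_nonneg (inv_nonneg.2 (hc.le.trans hω))]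
    exact inv_anti₀ hc hω

lemma gcomp_mul01 {Ω : Type*} {mΩ : MeasurableSpace Ω} {μ : Measure Ω}
    {P h : Ω → ℝ} (hP : Measurable P) (hP1 : ∀ ω, |P ω| ≤ 1) (hh : Integrable h μ) :
    Integrable (fun ω => P ω * h ω) μ :=
  Integrable.bdd_mul (c := 1) hh hP.aestronglyMeasurable (ae_of_all _ hP1)

lemma gcomp_step {Ω : Type*} {mΩ : MeasurableSpace Ω} {μ : Measure Ω} [IsProbabilityMeasure μ]
    {m : MeasurableSpace Ω} (hm : m ≤ mΩ) {T h Ya P : Ω → ℝ}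
    (hP : Measurable[m] P) (hP1 : ∀ ω, |P ω| ≤ 1)
    (hT : Measurable[mΩ] T) (hT1 : ∀ ω, |T ω| ≤ 1)
    (hh : Integrable h μ) (hYa : Integrable Ya μ)
    (hpos : ∃ c : ℝ, 0 < c ∧ ∀ᵐ ω ∂μ, c ≤ (μ[T|m]) ω)
    (hig : μ[fun ω => Ya ω * T ω|m] =ᵐ[μ] fun ω => (μ[Ya|m]) ω * (μ[T|m]) ω)
    (heq : μ[fun ω => P ω * (h ω * T ω)|m] =ᵐ[μ] μ[fun ω => P ω * (Ya ω * T ω)|m]) :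
    (fun ω => P ω * ((μ[fun ω => h ω * T ω|m]) ω / (μ[T|m]) ω)) =ᵐ[μ]
      fun ω => P ω * (μ[Ya|m]) ω := by
  obtain ⟨c, hc, hp⟩ := hpos
  have key : ∀ f : Ω → ℝ, Integrable f μ → μ[fun ω => P ω * (f ω * T ω)|m] =ᵐ[μ]
      fun ω => P ω * (μ[fun ω => f ω * T ω|m]) ω := by
    intro f hf
    have h1 : Integrable (fun ω => f ω * T ω) μ := by
      simpa only [mul_comm] using gcomp_mul01 hT hT1 hf
    exact condExp_mul_of_stronglyMeasurable_left hP.stronglyMeasurable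
      (gcomp_mul01 (hP.mono hm le_rfl) hP1 h1) h1
  filter_upwards [key h hh, key Ya hYa, hp, hig, heq] with ω h1 h2 h3 h4 h5
  have : (μ[T|m]) ω ≠ 0 := (hc.trans_le h3).ne'
  rw [h1, h2, h4] at h5
  rw [← mul_div_assoc, h5]
  field_simp

/-- **Proposition 1.** Regression-based iterative G-computation recovers
the conditional average potential outcome for a general prediction horizon `τ ≥ 1`:
defining recursively `g_{τ−1} := μ[Y·T_{τ−1} | 𝒢_{τ−1}]/π_{τ−1}` and, for `δ < τ−1`,
`g_δ := μ[g_{δ+1}·T_δ | 𝒢_δ]/π_δ` (with `π_δ := μ[T_δ | 𝒢_δ]`), one has, under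
consistency, sequential ignorability at every step, and positivity,
`μ[Ya | 𝒢₀] = g₀` `μ`-almost everywhere. -/
theorem gcomp_iterative_regression_recovers_capo
    {Ω : Type*} {mΩ : MeasurableSpace Ω} {μ : Measure Ω} [IsProbabilityMeasure μ]
    {τ : ℕ} (hτ : 1 ≤ τ)
    {𝒢 : ℕ → MeasurableSpace Ω}
    (hmono : ∀ δ, δ + 1 < τ → 𝒢 δ ≤ 𝒢 (δ + 1))
    (hle : ∀ δ, δ < τ → 𝒢 δ ≤ mΩ)
    {T : ℕ → Ω → ℝ}
    (hT : ∀ δ, δ < τ → Measurable (T δ))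
    (hTadapted : ∀ δ, δ + 1 < τ → Measurable[𝒢 (δ + 1)] (T δ))
    (hT01 : ∀ δ, δ < τ → ∀ ω, T δ ω = 0 ∨ T δ ω = 1)
    {Ya Y : Ω → ℝ} (hYa : Measurable Ya) (hY : Measurable Y)
    {CYa CY : ℝ} (hYaBd : ∀ ω, |Ya ω| ≤ CYa) (hYBd : ∀ ω, |Y ω| ≤ CY)
    (hconsistency : (fun ω => Y ω * ∏ δ ∈ Finset.range τ, T δ ω) =ᵐ[μ]
      fun ω => Ya ω * ∏ δ ∈ Finset.range τ, T δ ω)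
    (hignorability : ∀ δ, δ < τ → μ[fun ω => Ya ω * T δ ω|𝒢 δ] =ᵐ[μ]
      fun ω => (μ[Ya|𝒢 δ]) ω * (μ[T δ|𝒢 δ]) ω)
    (hpos : ∀ δ, δ < τ → ∃ c : ℝ, 0 < c ∧ ∀ᵐ ω ∂μ, c ≤ (μ[T δ|𝒢 δ]) ω)
    (g : ℕ → Ω → ℝ)
    (hg_last : g (τ - 1) = fun ω =>
      (μ[fun ω => Y ω * T (τ - 1) ω|𝒢 (τ - 1)]) ω / (μ[T (τ - 1)|𝒢 (τ - 1)]) ω)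
    (hg_rec : ∀ δ, δ < τ - 1 → g δ = fun ω =>
      (μ[fun ω => g (δ + 1) ω * T δ ω|𝒢 δ]) ω / (μ[T δ|𝒢 δ]) ω) :
    μ[Ya|𝒢 0] =ᵐ[μ] g 0 := by
  have hYaI : Integrable Ya μ :=
    Integrable.of_bound hYa.aestronglyMeasurable CYa (ae_of_all _ hYaBd)
  have hYI : Integrable Y μ :=
    Integrable.of_bound hY.aestronglyMeasurable CY (ae_of_all _ hYBd)
  have hT1 : ∀ δ, δ < τ → ∀ ω, |T δ ω| ≤ 1 := by
    intro δ hδ ω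
    rcases hT01 δ hδ ω with h | h <;> simp [h]
  have hgI : ∀ δ, δ < τ → Integrable (g δ) μ := by
    intro δ hδ
    by_cases h : δ = τ - 1
    · subst h
      rw [hg_last]
      exact gcomp_int_g (hle _ hδ) _ _ (hpos _ hδ)
    · rw [hg_rec δ (by omega)]
      exact gcomp_int_g (hle _ hδ) _ _ (hpos _ hδ)
  let P : ℕ → Ω → ℝ := fun n ω => ∏ k ∈ Finset.range n, T k ω
  have hPs : ∀ n ω, P (n + 1) ω = P n ω * T n ω := fun n ω => Finset.prod_range_succ _ _
  have hP1 : ∀ n, n ≤ τ → ∀ ω, |P n ω| ≤ 1 := by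
    intro n hn ω
    simp only [P, Finset.abs_prod]
    refine Finset.prod_le_one (fun _ _ => abs_nonneg _) (fun i hi => hT1 i ?_ ω)
    have := Finset.mem_range.1 hi
    omega
  have hPm : ∀ n, n < τ → Measurable[𝒢 n] (P n) := by
    intro n
    induction n with
    | zero => intro _; simp only [P, Finset.range_zero, Finset.prod_empty]; exact measurable_const
    | succ n ih =>
      intro hn
      have e : P (n + 1) = fun ω => P n ω * T n ω := funext (hPs n)
      rw [e]
      exact ((ih (by omega)).mono (hmono n hn) le_rfl).mul (hTadapted n hn)
  have main : ∀ k δ, δ + k + 1 = τ →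
      (fun ω => P δ ω * g δ ω) =ᵐ[μ] fun ω => P δ ω * (μ[Ya|𝒢 δ]) ω := by
    intro k
    induction k with
    | zero =>
      intro δ hδ
      have hlt : δ < τ := by omega
      have e : δ = τ - 1 := by omega
      rw [← e] at hg_last
      rw [hg_last]
      refine gcomp_step (hle δ hlt) (hPm δ hlt) (hP1 δ hlt.le) (hT δ hlt) (hT1 δ hlt) hYI hYaI
        (hpos δ hlt) (hignorability δ hlt) (condExp_congr_ae ?_)
      have e2 : τ = δ + 1 := by omega
      filter_upwards [hconsistency] with ω hω
      rw [e2, Finset.prod_range_succ] at hω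
      simp only [P]
      linarith
    | succ k ih =>
      intro δ hδ
      have hlt : δ < τ := by omega
      have hlt' : δ + 1 < τ := by omega
      rw [hg_rec δ (by omega)]
      refine gcomp_step (hle δ hlt) (hPm δ hlt) (hP1 δ hlt.le) (hT δ hlt) (hT1 δ hlt)
        (hgI _ hlt') hYaI (hpos δ hlt) (hignorability δ hlt) ?_
      have h1 : (fun ω => P δ ω * (g (δ + 1) ω * T δ ω)) =ᵐ[μ]
          μ[fun ω => P δ ω * (Ya ω * T δ ω)|𝒢 (δ + 1)] := by
        have e : (fun ω => P δ ω * (Ya ω * T δ ω)) = P (δ + 1) * Ya := by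
          funext ω
          rw [Pi.mul_apply, hPs]
          ring
        rw [e]
        have h2 := condExp_mul_of_stronglyMeasurable_left (μ := μ)
          (hPm _ hlt').stronglyMeasurable
          (gcomp_mul01 ((hPm _ hlt').mono (hle _ hlt') le_rfl) (hP1 _ hlt'.le) hYaI) hYaI
        filter_upwards [h2, ih (δ + 1) (by omega)] with ω h3 h4
        rw [h3, Pi.mul_apply, ← h4, hPs]
        ring
      exact (condExp_congr_ae h1).trans
        (condExp_condExp_of_le (hmono δ hlt') (hle _ hlt'))
  filter_upwards [main (τ - 1) 0 (by omega)] with ω hω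
  simpa [P] using hω.symm
end

section
/- Both pseudo-outcomes are unbiased for the average potential outcome: under consistency, sequential ignorability, and positivity, and assuming Y·T/π is μ-integrable where π := μ[T | 𝒢], one has ∫ (Y·T)/π dμ = ∫ μ[Y·T | 𝒢]/π dμ = ∫ Ya dμ; i.e., the mean of the IPW pseudo-outcome and the mean of the G-computation pseudo-outcome both equal E[Y[a]]. -/
open MeasureTheory ProbabilityTheory

/-- Both pseudo-outcomes are unbiased for the average potential outcome:
under consistency, sequential ignorability, and positivity (with `π := μ[T | 𝒢]`), and
assuming `Y·T/π` is integrable, one has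
`∫ Y·T/π dμ = ∫ μ[Y·T | 𝒢]/π dμ = ∫ Ya dμ`. -/
theorem ipw_and_gcomp_unbiased
    {Ω : Type*} {mΩ : MeasurableSpace Ω} {μ : Measure Ω} [IsProbabilityMeasure μ]
    {m : MeasurableSpace Ω} (hm : m ≤ mΩ)
    {T Ya Y : Ω → ℝ} (hT : Measurable T) (hYa : Measurable Ya) (hY : Measurable Y)
    (hT01 : ∀ ω, T ω = 0 ∨ T ω = 1)
    (hYaInt : Integrable Ya μ)
    (hYTInt : Integrable (fun ω => Y ω * T ω) μ)
    (hIPWInt : Integrable (fun ω => Y ω * T ω / (μ[T|m]) ω) μ)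
    (hconsistency : (fun ω => Y ω * T ω) =ᵐ[μ] fun ω => Ya ω * T ω)
    (hignorability : μ[fun ω => Ya ω * T ω|m] =ᵐ[μ]
      fun ω => (μ[Ya|m]) ω * (μ[T|m]) ω)
    (hpos : ∀ᵐ ω ∂μ, 0 < (μ[T|m]) ω) :
    ∫ ω, Y ω * T ω / (μ[T|m]) ω ∂μ =
        ∫ ω, (μ[fun ω => Y ω * T ω|m]) ω / (μ[T|m]) ω ∂μ ∧
      ∫ ω, (μ[fun ω => Y ω * T ω|m]) ω / (μ[T|m]) ω ∂μ = ∫ ω, Ya ω ∂μ := by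
  have hinv : StronglyMeasurable[m] (fun ω => ((μ[T|m]) ω)⁻¹) :=
    (stronglyMeasurable_condExp.measurable.inv).stronglyMeasurable
  have hpull : μ[(fun ω => Y ω * T ω) * (fun ω => ((μ[T|m]) ω)⁻¹)|m] =ᵐ[μ]
      μ[fun ω => Y ω * T ω|m] * (fun ω => ((μ[T|m]) ω)⁻¹) :=
    condExp_mul_of_stronglyMeasurable_right hinv hIPWInt hYTInt
  constructor
  · have h1 := integral_congr_ae hpull
    rw [integral_condExp hm] at h1
    exact h1
  · have h2 : (fun ω => (μ[fun ω => Y ω * T ω|m]) ω / (μ[T|m]) ω) =ᵐ[μ] μ[Ya|m] := by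
      filter_upwards [condExp_congr_ae (m := m) hconsistency, hignorability, hpos]
        with ω h1 h2 h3
      rw [h1, h2, mul_div_cancel_right₀ _ h3.ne']
    rw [integral_congr_ae h2, integral_condExp hm]
end
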